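/- arXiv:2412.18640 — 4 statements merged into one kernel-verified Lean document; each statement's English description precedes it below -/
import Mathlib

section
/- The set {|Aut(G)| / |G| : G a finite abelian group} is dense in the interval [0, ∞). -/
theorem MonoidHom.map_eq_one_of_coprime_card {A B : Type*} [Group A] [Group B]
    (h : (Nat.card A).Coprime (Nat.card B)) (f : A →* B) (a : A) : f a = 1 :=
  orderOf_eq_one_iff.mp <| Nat.eq_one_of_dvd_coprimes h
    ((orderOf_map_dvd f a).trans (orderOf_dvd_natCard a)) (orderOf_dvd_natCard _)

theorem MulEquiv.apply_eq_of_coprime_card {A B : Type*} [Group A] [Group B]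
    (h : (Nat.card A).Coprime (Nat.card B)) (e : A × B ≃* A × B) (a : A) (b : B) :
    e (a, b) = ((e (a, 1)).1, (e (1, b)).2) := by
  have h1 : (e (1, b)).1 = 1 := MonoidHom.map_eq_one_of_coprime_card h.symm
    ((MonoidHom.fst A B).comp (e.toMonoidHom.comp (MonoidHom.inr A B))) b
  have h2 : (e (a, 1)).2 = 1 := MonoidHom.map_eq_one_of_coprime_card h
    ((MonoidHom.snd A B).comp (e.toMonoidHom.comp (MonoidHom.inl A B))) a
  have h3 : e (a, b) = e (a, 1) * e (1, b) := by rw [← map_mul]; simp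
  rw [h3]
  ext <;> simp [h1, h2]

theorem MulEquiv.prodCongr_surjective_of_coprime_card {A B : Type*} [Group A] [Group B]
    (h : (Nat.card A).Coprime (Nat.card B)) (e : A × B ≃* A × B) :
    ∃ (f : A ≃* A) (g : B ≃* B), f.prodCongr g = e := by
  have key : ∀ (e' e'' : A × B ≃* A × B), (∀ x, e'' (e' x) = x) →
      (∀ a, (e'' ((e' (a, 1)).1, 1)).1 = a) ∧ ∀ b, (e'' (1, (e' (1, b)).2)).2 = b := by
    intro e' e'' he
    refine ⟨fun a => ?_, fun b => ?_⟩
    · have := he (a, 1)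
      rw [e'.apply_eq_of_coprime_card h, e''.apply_eq_of_coprime_card h] at this
      exact congrArg Prod.fst this
    · have := he (1, b)
      rw [e'.apply_eq_of_coprime_card h, e''.apply_eq_of_coprime_card h] at this
      exact congrArg Prod.snd this
  have k1 := key e e.symm e.symm_apply_apply
  have k2 := key e.symm e e.apply_symm_apply
  refine ⟨MonoidHom.toMulEquiv
      ((MonoidHom.fst A B).comp (e.toMonoidHom.comp (MonoidHom.inl A B)))
      ((MonoidHom.fst A B).comp (e.symm.toMonoidHom.comp (MonoidHom.inl A B)))
      (MonoidHom.ext k1.1) (MonoidHom.ext k2.1),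
    MonoidHom.toMulEquiv
      ((MonoidHom.snd A B).comp (e.toMonoidHom.comp (MonoidHom.inr A B)))
      ((MonoidHom.snd A B).comp (e.symm.toMonoidHom.comp (MonoidHom.inr A B)))
      (MonoidHom.ext k1.2) (MonoidHom.ext k2.2), ?_⟩
  ext1 ⟨a, b⟩
  exact (e.apply_eq_of_coprime_card h a b).symm

theorem Nat.card_mulEquiv_prod_of_coprime_card {A B : Type*} [Group A] [Group B]
    (h : (Nat.card A).Coprime (Nat.card B)) :
    Nat.card (A × B ≃* A × B) = Nat.card (A ≃* A) * Nat.card (B ≃* B) := by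
  rw [← Nat.card_prod]
  refine (Nat.card_congr (Equiv.ofBijective
    (fun p : (A ≃* A) × (B ≃* B) => p.1.prodCongr p.2) ⟨?_, fun e => ?_⟩)).symm
  · rintro ⟨f, g⟩ ⟨f', g'⟩ hfg
    exact Prod.ext
      (MulEquiv.ext fun a => congrArg Prod.fst (DFunLike.congr_fun hfg (a, (1 : B))))
      (MulEquiv.ext fun b => congrArg Prod.snd (DFunLike.congr_fun hfg ((1 : A), b)))
  · obtain ⟨f, g, hfg⟩ := MulEquiv.prodCongr_surjective_of_coprime_card h e
    exact ⟨(f, g), hfg⟩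

/-- The elementary abelian group of rank `n + 3` has at least `2 ^ ((n + 3) * (n + 2))`
automorphisms. -/
theorem two_pow_le_card_mulEquiv_elementary (n : ℕ) :
    2 ^ ((n + 3) * (n + 2)) ≤ Nat.card
      (Multiplicative (Fin (n + 3) → ZMod 2) ≃* Multiplicative (Fin (n + 3) → ZMod 2)) := by
  have : Fact (Nat.Prime 2) := ⟨Nat.prime_two⟩
  calc 2 ^ ((n + 3) * (n + 2)) = ∏ _i : Fin (n + 3), 2 ^ (n + 2) := by
        rw [Finset.prod_const, Finset.card_univ, Fintype.card_fin, ← pow_mul, mul_comm]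
    _ ≤ ∏ i : Fin (n + 3), (Fintype.card (ZMod 2) ^ (n + 3) - Fintype.card (ZMod 2) ^ (i : ℕ)) := by
        refine Finset.prod_le_prod' fun i _ => ?_
        rw [ZMod.card]
        have : 2 ^ (i : ℕ) ≤ 2 ^ (n + 2) := Nat.pow_le_pow_right two_pos (by omega)
        have : 2 ^ (n + 3) = 2 ^ (n + 2) * 2 := pow_succ 2 (n + 2)
        omega
    _ = Nat.card (GL (Fin (n + 3)) (ZMod 2)) := (Matrix.card_GL_field _).symm
    _ ≤ _ := by
        refine Nat.card_le_card_of_injective (fun M => AddEquiv.toMultiplicative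
          (LinearMap.GeneralLinearGroup.toLinearEquiv
            (Matrix.GeneralLinearGroup.toLin M)).toAddEquiv) fun M N hMN => ?_
        refine Matrix.GeneralLinearGroup.toLin.injective ?_
        ext1
        refine LinearMap.ext fun v => ?_
        exact DFunLike.congr_fun hMN (Multiplicative.ofAdd v)

theorem Nat.totient_prod_primes_div (s : Finset ℕ) (hs : ∀ p ∈ s, p.Prime) :
    ((∏ p ∈ s, p).totient : ℝ) / (∏ p ∈ s, p : ℕ) = ∏ p ∈ s, (1 - (p : ℝ)⁻¹) := by
  have h := Nat.totient_eq_mul_prod_factors (∏ p ∈ s, p)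
  rw [Nat.primeFactors_prod hs] at h
  have h0 : ((∏ p ∈ s, p : ℕ) : ℝ) ≠ 0 :=
    Nat.cast_ne_zero.mpr (Finset.prod_ne_zero_iff.mpr fun p hp => (hs p hp).ne_zero)
  rw [div_eq_iff h0, mul_comm]
  have h' := congrArg (Rat.cast : ℚ → ℝ) h
  push_cast at h' ⊢
  exact h'

open Filter Topology in
theorem tendsto_prod_one_sub_inv_primes (N : ℕ) :
    Tendsto (fun k => ∏ p ∈ (Finset.Ico N k).filter Nat.Prime, (1 - (p : ℝ)⁻¹)) atTop (𝓝 0) := by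
  set f : ℕ → ℝ := Set.indicator {p | p.Prime} (fun n : ℕ => (1 : ℝ) / n) with hf
  have hf0 : ∀ n, 0 ≤ f n := fun n => Set.indicator_nonneg (fun _ _ => by positivity) n
  have h1 : Tendsto (fun k => ∑ i ∈ Finset.range k, f i) atTop atTop :=
    (not_summable_iff_tendsto_nat_atTop_of_nonneg hf0).mp not_summable_one_div_on_primes
  have h2 : Tendsto (fun k => ∑ i ∈ Finset.range k, f i - ∑ i ∈ Finset.range N, f i)
      atTop atTop := tendsto_atTop_add_const_right _ _ h1
  refine squeeze_zero' (.of_forall fun k => Finset.prod_nonneg fun p hp => ?_) ?_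
    (Real.tendsto_exp_neg_atTop_nhds_zero.comp h2)
  · have := (Finset.mem_filter.mp hp).2.one_lt
    exact sub_nonneg.mpr (inv_le_one_of_one_le₀ (by exact_mod_cast this.le))
  · filter_upwards [eventually_ge_atTop N] with k hk
    simp only [Function.comp]
    rw [← Finset.sum_Ico_eq_sub _ hk]
    have : ∑ i ∈ Finset.Ico N k, f i
        = ∑ p ∈ (Finset.Ico N k).filter Nat.Prime, (p : ℝ)⁻¹ := by
      rw [Finset.sum_filter]
      refine Finset.sum_congr rfl fun p _ => ?_
      simp [hf, Set.indicator_apply]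
    rw [this, ← Finset.sum_neg_distrib, Real.exp_sum]
    refine Finset.prod_le_prod (fun p hp => ?_) fun p _ => ?_
    · have := (Finset.mem_filter.mp hp).2.one_lt
      exact sub_nonneg.mpr (inv_le_one_of_one_le₀ (by exact_mod_cast this.le))
    · linarith [Real.add_one_le_exp (-(p : ℝ)⁻¹)]

/-- Multiplying `c > x` by successive factors `1 - 1 / p` over primes `p ≥ N`, the first value
not exceeding `x` is at least `x * (1 - 1 / N)`. -/
theorem exists_prod_one_sub_inv_primes_mem_Icc {c x : ℝ} (hx : 0 < x) (hc : x < c) {N : ℕ}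
    (hN : 0 < N) :
    ∃ k, c * ∏ p ∈ (Finset.Ico N k).filter Nat.Prime, (1 - (p : ℝ)⁻¹) ∈
      Set.Icc (x * (1 - (N : ℝ)⁻¹)) x := by
  classical
  have hN1 : 0 ≤ 1 - (N : ℝ)⁻¹ := sub_nonneg.mpr (inv_le_one_of_one_le₀ (by exact_mod_cast hN))
  have hex : ∃ k, c * ∏ p ∈ (Finset.Ico N k).filter Nat.Prime, (1 - (p : ℝ)⁻¹) ≤ x := by
    have := (tendsto_prod_one_sub_inv_primes N).const_mul c
    rw [mul_zero] at this
    exact (this.eventually_le_const hx).exists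
  refine ⟨Nat.find hex, ?_, Nat.find_spec hex⟩
  obtain hk | ⟨k, hk⟩ := (eq_or_ne (Nat.find hex) 0).imp_right Nat.exists_eq_succ_of_ne_zero
  · have := Nat.find_spec hex
    simp [hk] at this
    linarith
  have hlt : x < c * ∏ p ∈ (Finset.Ico N k).filter Nat.Prime, (1 - (p : ℝ)⁻¹) :=
    not_le.mp (Nat.find_min hex (by omega))
  have hx1 : x * (1 - (N : ℝ)⁻¹) ≤ x :=
    mul_le_of_le_one_right hx.le (by linarith [inv_nonneg.mpr (Nat.cast_nonneg (α := ℝ) N)])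
  rw [hk, Nat.succ_eq_add_one]
  by_cases hNk : N ≤ k
  · rw [← Finset.insert_Ico_right_eq_Ico_add_one hNk, Finset.filter_insert]
    split_ifs
    · rw [Finset.prod_insert (by simp), mul_left_comm, mul_comm]
      have : (k : ℝ)⁻¹ ≤ (N : ℝ)⁻¹ := by gcongr
      exact mul_le_mul (by linarith) hlt.le hx.le (by linarith)
    · exact hx1.trans hlt.le
  · rw [Finset.Ico_eq_empty (by omega)] at *
    exact hx1.trans hlt.le

/-- The set `{|Aut(G)| / |G| : G a finite abelian group}` is dense in `[0, ∞)`. -/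
theorem aut_ratio_dense_in_nonneg :
    ∀ x ∈ Set.Ici (0 : ℝ), x ∈ closure {r : ℝ | ∃ (G : Type) (_ : CommGroup G) (_ : Finite G),
      r = (Nat.card (G ≃* G) : ℝ) / (Nat.card G : ℝ)} := by
  suffices h : Set.Ioi (0 : ℝ) ⊆ closure {r : ℝ | ∃ (G : Type) (_ : CommGroup G) (_ : Finite G),
      r = (Nat.card (G ≃* G) : ℝ) / (Nat.card G : ℝ)} by
    intro x hx
    rw [← closure_Ioi] at hx
    exact closure_minimal h isClosed_closure hx
  intro x (hx : 0 < x)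
  obtain ⟨n, hn⟩ := exists_nat_gt x
  set A := Multiplicative (Fin (n + 3) → ZMod 2) with hA
  have hcardA : Nat.card A = 2 ^ (n + 3) := by
    simp [hA, Nat.card_eq_fintype_card]
  have hc : x < (Nat.card (A ≃* A) : ℝ) / (Nat.card A : ℝ) := by
    rw [hcardA, lt_div_iff₀ (by positivity)]
    calc x * (2 ^ (n + 3) : ℕ) < n * (2 ^ (n + 3) : ℕ) := by gcongr
      _ ≤ 2 ^ n * 2 ^ (n + 3) := by
        exact_mod_cast Nat.mul_le_mul_right _ Nat.lt_two_pow_self.le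
      _ ≤ 2 ^ ((n + 3) * (n + 2)) := by
        rw [← pow_add]
        exact pow_le_pow_right₀ one_le_two (by nlinarith)
      _ ≤ _ := by exact_mod_cast two_pow_le_card_mulEquiv_elementary n
  rw [Metric.mem_closure_iff]
  intro ε hε
  obtain ⟨N, hN⟩ := exists_nat_gt (max 3 (x / ε))
  have hN3 : 3 < N := by exact_mod_cast (le_max_left _ _).trans_lt hN
  have hN0 : (0 : ℝ) < N := by exact_mod_cast (by omega : 0 < N)
  have hNx : x * (N : ℝ)⁻¹ < ε := by
    rw [← div_eq_mul_inv, div_lt_iff₀ hN0, mul_comm, ← div_lt_iff₀ hε]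
    exact (le_max_right _ _).trans_lt hN
  obtain ⟨k, hk1, hk2⟩ := exists_prod_one_sub_inv_primes_mem_Icc hx hc (N := N) (by omega)
  set s := (Finset.Ico N k).filter Nat.Prime with hs
  have hsp : ∀ p ∈ s, p.Prime := fun p hp => (Finset.mem_filter.mp hp).2
  set m := ∏ p ∈ s, p with hm
  have : NeZero m := ⟨Finset.prod_ne_zero_iff.mpr fun p hp => (hsp p hp).ne_zero⟩
  have hcop : (Nat.card A).Coprime (Nat.card (Multiplicative (ZMod m))) := by
    rw [hcardA, Nat.card_congr Multiplicative.toAdd, Nat.card_zmod]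
    refine Nat.Coprime.pow_left _ (Nat.Coprime.prod_right fun p hp => ?_)
    refine (Nat.coprime_primes Nat.prime_two (hsp p hp)).mpr ?_
    have := (Finset.mem_Ico.mp (Finset.mem_filter.mp hp).1).1
    omega
  refine ⟨_, ⟨A × Multiplicative (ZMod m), inferInstance, inferInstance, rfl⟩, ?_⟩
  have haut : Nat.card (Multiplicative (ZMod m) ≃* Multiplicative (ZMod m)) = m.totient := by
    have := IsCyclic.card_mulAut (Multiplicative (ZMod m))
    rwa [Nat.card_congr Multiplicative.toAdd, Nat.card_zmod] at this
  rw [Nat.card_mulEquiv_prod_of_coprime_card hcop, Nat.card_prod, haut,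
    Nat.card_congr (Multiplicative.toAdd (α := ZMod m)), Nat.card_zmod, Nat.cast_mul, Nat.cast_mul,
    mul_div_mul_comm, Nat.totient_prod_primes_div s hsp, Real.dist_eq, abs_lt]
  constructor <;> linarith
end

section
/- The set {|Aut(G)| / |G| : G a finite abelian group} ∩ [0, 1] is dense in the interval [0, 1]. -/
open Finset in
/-- The product of the primes in `[N, N + k)`. -/
def primeWindowProd (N k : ℕ) : ℕ :=
  ∏ i ∈ range k, if (N + i).Prime then N + i else 1

theorem primeWindowProd_succ (N k : ℕ) :
    primeWindowProd N (k + 1) =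
      primeWindowProd N k * if (N + k).Prime then N + k else 1 :=
  Finset.prod_range_succ _ _

theorem primeWindowProd_pos (N k : ℕ) : 0 < primeWindowProd N k := by
  refine Finset.prod_pos fun i _ => ?_
  split_ifs with h
  · exact h.pos
  · exact one_pos

theorem coprime_primeWindowProd {N k : ℕ} (h : (N + k).Prime) :
    (primeWindowProd N k).Coprime (N + k) := by
  refine Nat.Coprime.prod_left fun i hi => ?_
  split_ifs with hi'
  · rw [Nat.coprime_primes hi' h]
    have := Finset.mem_range.1 hi
    omega
  · exact Nat.coprime_one_left _

/-- The indicator of the primes, weighted by `1 / p`. -/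
noncomputable def primeReciprocal (n : ℕ) : ℝ :=
  Set.indicator {p : ℕ | p.Prime} (fun n : ℕ => (1 : ℝ) / n) n

theorem primeReciprocal_nonneg (n : ℕ) : 0 ≤ primeReciprocal n :=
  Set.indicator_nonneg (fun _ _ => by positivity) _

theorem primeReciprocal_le (n : ℕ) : primeReciprocal n ≤ 1 / n :=
  Set.indicator_le_self' (fun _ _ => by positivity) _

/-- The ratio `φ(n) / n` for `n` the product of the primes in `[N, N + k)`. -/
noncomputable def primeWindowRatio (N k : ℕ) : ℝ :=
  (primeWindowProd N k).totient / primeWindowProd N k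

theorem primeWindowRatio_zero (N : ℕ) : primeWindowRatio N 0 = 1 := by
  simp [primeWindowRatio, primeWindowProd]

theorem primeWindowRatio_succ (N k : ℕ) :
    primeWindowRatio N (k + 1) = primeWindowRatio N k * (1 - primeReciprocal (N + k)) := by
  unfold primeWindowRatio primeReciprocal
  rw [primeWindowProd_succ]
  by_cases h : (N + k).Prime
  · have hp : ((N + k : ℕ) : ℝ) ≠ 0 := by exact_mod_cast h.ne_zero
    have hn : (primeWindowProd N k : ℝ) ≠ 0 := by
      exact_mod_cast (primeWindowProd_pos N k).ne'
    rw [if_pos h, Nat.totient_mul (coprime_primeWindowProd h), Nat.totient_prime h,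
      Set.indicator_of_mem (show N + k ∈ {p : ℕ | p.Prime} from h), Nat.cast_mul, Nat.cast_mul,
      Nat.cast_sub h.one_le, Nat.cast_one]
    field_simp
  · simp [h]

theorem primeWindowRatio_nonneg (N k : ℕ) : 0 ≤ primeWindowRatio N k := by
  unfold primeWindowRatio
  positivity

theorem primeWindowRatio_le_one (N k : ℕ) : primeWindowRatio N k ≤ 1 :=
  div_le_one_of_le₀ (by exact_mod_cast Nat.totient_le _) (by positivity)

theorem primeWindowRatio_le_exp (N k : ℕ) :
    primeWindowRatio N k ≤ Real.exp (-∑ i ∈ Finset.range k, primeReciprocal (N + i)) := by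
  induction k with
  | zero => simp [primeWindowRatio_zero]
  | succ k ih =>
    rw [primeWindowRatio_succ, Finset.sum_range_succ, neg_add, Real.exp_add]
    calc primeWindowRatio N k * (1 - primeReciprocal (N + k))
        ≤ primeWindowRatio N k * Real.exp (-primeReciprocal (N + k)) :=
          mul_le_mul_of_nonneg_left (Real.one_sub_le_exp_neg _) (primeWindowRatio_nonneg N k)
      _ ≤ _ := mul_le_mul_of_nonneg_right ih (Real.exp_pos _).le

open Filter Topology in
theorem tendsto_primeWindowRatio (N : ℕ) : Tendsto (primeWindowRatio N) atTop (𝓝 0) := by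
  have hs : ¬ Summable fun i => primeReciprocal (N + i) := by
    simp_rw [add_comm N]
    rw [summable_nat_add_iff N]
    exact not_summable_one_div_on_primes
  have ht := (not_summable_iff_tendsto_nat_atTop_of_nonneg
    fun i => primeReciprocal_nonneg (N + i)).1 hs
  exact squeeze_zero (primeWindowRatio_nonneg N) (primeWindowRatio_le_exp N)
    (Real.tendsto_exp_neg_atTop_nhds_zero.comp ht)

theorem exists_primeWindowRatio_mem_Ico {x ε : ℝ} (hx : x ∈ Set.Icc (0 : ℝ) 1) (hε : 0 < ε) :
    ∃ N k, primeWindowRatio N k ∈ Set.Ico x (x + ε) := by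
  classical
  obtain ⟨n, hn⟩ := exists_nat_one_div_lt hε
  have hex : ∃ k, primeWindowRatio (n + 1) k < x + ε :=
    ((tendsto_primeWindowRatio (n + 1)).eventually_lt_const (by linarith [hx.1])).exists
  refine ⟨n + 1, Nat.find hex, ?_, Nat.find_spec hex⟩
  rcases h : Nat.find hex with _ | k
  · rw [primeWindowRatio_zero]
    exact hx.2
  · have hk : x + ε ≤ primeWindowRatio (n + 1) k :=
      not_lt.1 (Nat.find_min hex (by omega))
    have hr : primeReciprocal (n + 1 + k) ≤ ε := by
      refine (primeReciprocal_le _).trans (le_trans ?_ hn.le)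
      push_cast
      exact one_div_le_one_div_of_le (by positivity) (by simp)
    rw [primeWindowRatio_succ]
    nlinarith [mul_le_mul (primeWindowRatio_le_one (n + 1) k) hr
      (primeReciprocal_nonneg _) zero_le_one]

theorem card_mulEquiv_multiplicative_zmod (n : ℕ) [NeZero n] :
    Nat.card (Multiplicative (ZMod n) ≃* Multiplicative (ZMod n)) = n.totient := by
  have := IsCyclic.card_mulAut (Multiplicative (ZMod n))
  simpa using this


/-- The set `{|Aut(G)| / |G| : G a finite abelian group} ∩ [0, 1]` is dense in `[0, 1]`. -/
theorem aut_ratio_inter_unitInterval_dense :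
    ∀ x ∈ Set.Icc (0 : ℝ) 1, x ∈ closure ({r : ℝ | ∃ (G : Type) (_ : CommGroup G) (_ : Finite G),
      r = (Nat.card (G ≃* G) : ℝ) / (Nat.card G : ℝ)} ∩ Set.Icc (0 : ℝ) 1) := by
  intro x hx
  refine Metric.mem_closure_iff.2 fun ε hε => ?_
  obtain ⟨N, k, hxk, hkx⟩ := exists_primeWindowRatio_mem_Ico hx hε
  have : NeZero (primeWindowProd N k) := ⟨(primeWindowProd_pos N k).ne'⟩
  refine ⟨primeWindowRatio N k, ⟨⟨Multiplicative (ZMod (primeWindowProd N k)), inferInstance,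
    inferInstance, ?_⟩, primeWindowRatio_nonneg N k, primeWindowRatio_le_one N k⟩, ?_⟩
  · rw [card_mulEquiv_multiplicative_zmod, Nat.card_congr Multiplicative.toAdd, Nat.card_zmod]
    rfl
  · rw [Real.dist_eq, abs_sub_lt_iff]
    constructor <;> linarith
end

section
/- The set {|Aut(G)| / |G| : G a finite abelian group of odd order} ∩ [0, 1] is dense in the interval [0, 1]. -/
open Filter Topology in
/-- The products `∏ (1 - 1 / p)` over the primes `p` in `[N, N + m)` tend to zero. -/
theorem tendsto_prod_one_sub_indicator_primes (N : ℕ) (hN : 1 ≤ N) :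
    Tendsto (fun m => ∏ i ∈ Finset.range m,
      (1 - Set.indicator {p : ℕ | p.Prime} (fun n : ℕ => (1 : ℝ) / n) (i + N))) atTop (𝓝 0) := by
  set h : ℕ → ℝ := Set.indicator {p : ℕ | p.Prime} (fun n : ℕ => (1 : ℝ) / n)
  have h_nonneg : ∀ n, 0 ≤ h n := fun n => Set.indicator_nonneg (fun _ _ => by positivity) n
  have h_le_one : ∀ n, 1 ≤ n → h n ≤ 1 := fun n hn =>
    (Set.indicator_le_self' (fun _ _ => by positivity) n).trans
      (div_le_one_of_le₀ (Nat.one_le_cast.2 hn) (by positivity))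
  have h_sum : Tendsto (fun m => ∑ i ∈ Finset.range m, h (i + N)) atTop atTop := by
    rw [← not_summable_iff_tendsto_nat_atTop_of_nonneg fun n => h_nonneg _,
      summable_nat_add_iff N]
    exact not_summable_one_div_on_primes
  refine squeeze_zero (fun m => Finset.prod_nonneg fun i _ => ?_) (fun m => ?_)
    (Real.tendsto_exp_neg_atTop_nhds_zero.comp h_sum)
  · linarith [h_le_one (i + N) (by omega)]
  · rw [Function.comp_apply, ← Finset.sum_neg_distrib, Real.exp_sum]
    refine Finset.prod_le_prod (fun i _ => ?_) fun i _ => ?_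
    · linarith [h_le_one (i + N) (by omega)]
    · exact Real.one_sub_le_exp_neg _

/-- The product `∏ (1 - 1 / p)` over the primes `p` in `[N, N + m)` is `φ n / n` for some odd `n`,
provided that `N ≥ 3`. -/
theorem exists_odd_totient_div_eq_prod (N : ℕ) (hN : 3 ≤ N) (m : ℕ) :
    ∃ n : ℕ, Odd n ∧ (∀ q : ℕ, q.Prime → q ∣ n → q < m + N) ∧
      (n.totient : ℝ) / n = ∏ i ∈ Finset.range m,
        (1 - Set.indicator {p : ℕ | p.Prime} (fun n : ℕ => (1 : ℝ) / n) (i + N)) := by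
  induction m with
  | zero => exact ⟨1, odd_one, fun q hq h => absurd (Nat.dvd_one.1 h) hq.ne_one, by simp⟩
  | succ m ih =>
    obtain ⟨n, h_odd, h_lt, h_eq⟩ := ih
    rw [Finset.prod_range_succ, ← h_eq]
    by_cases hp : (m + N).Prime
    · refine ⟨n * (m + N), h_odd.mul (hp.odd_of_ne_two (by omega)), fun q hq hd => ?_, ?_⟩
      · rcases hq.dvd_mul.1 hd with hd | hd
        · have := h_lt q hq hd
          omega
        · have := Nat.le_of_dvd hp.pos hd
          omega
      · have h_coprime : n.Coprime (m + N) :=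
          ((Nat.Prime.coprime_iff_not_dvd hp).2 fun hd => (h_lt _ hp hd).false).symm
        have h_ne : ((m + N : ℕ) : ℝ) ≠ 0 := by exact_mod_cast hp.ne_zero
        rw [Set.indicator_of_mem (show m + N ∈ {p : ℕ | p.Prime} from hp),
          Nat.totient_mul h_coprime, Nat.totient_prime hp, Nat.cast_mul, Nat.cast_mul,
          Nat.cast_sub hp.one_le, mul_div_mul_comm, sub_div, div_self h_ne, Nat.cast_one]
    · refine ⟨n, h_odd, fun q hq hd => (h_lt q hq hd).trans (by omega), ?_⟩
      rw [Set.indicator_of_notMem (show m + N ∉ {p : ℕ | p.Prime} from hp), sub_zero, mul_one]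

/-- The values `φ n / n` for odd `n` are dense in `[0, 1]`. -/
theorem exists_odd_abs_totient_div_sub_lt {x ε : ℝ} (hx : x ∈ Set.Icc (0 : ℝ) 1) (hε : 0 < ε) :
    ∃ n : ℕ, Odd n ∧ |(n.totient : ℝ) / n - x| < ε := by
  obtain ⟨K, hK⟩ := exists_nat_one_div_lt hε
  set N := K + 3
  have h_ex : ∃ m, ∏ i ∈ Finset.range m,
      (1 - Set.indicator {p : ℕ | p.Prime} (fun n : ℕ => (1 : ℝ) / n) (i + N)) < x + ε :=
    ((tendsto_prod_one_sub_indicator_primes N (by omega)).eventually_lt_const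
      (by linarith [hx.1])).exists
  classical
  have h_spec := Nat.find_spec h_ex
  have h_min := fun k => Nat.find_min (m := k) h_ex
  generalize Nat.find h_ex = k at h_spec h_min
  obtain ⟨n, h_odd, -, h_eq⟩ := exists_odd_totient_div_eq_prod N (by omega) k
  refine ⟨n, h_odd, ?_⟩
  rw [h_eq, abs_lt]
  refine ⟨?_, by linarith⟩
  cases k with
  | zero =>
    rw [Finset.prod_range_zero]
    linarith [hx.2]
  | succ k =>
    have h_prev := h_min k k.lt_succ_self
    obtain ⟨l, -, -, hl⟩ := exists_odd_totient_div_eq_prod N (by omega) k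
    rw [← hl] at h_prev
    have hl_le : (l.totient : ℝ) / l ≤ 1 :=
      div_le_one_of_le₀ (by exact_mod_cast l.totient_le) (by positivity)
    have hl_nonneg : 0 ≤ (l.totient : ℝ) / l := by positivity
    have h_ind : Set.indicator {p : ℕ | p.Prime} (fun n : ℕ => (1 : ℝ) / n) (k + N) < ε := by
      refine lt_of_le_of_lt (Set.indicator_le_self' (fun _ _ => by positivity) _)
        (lt_of_le_of_lt ?_ hK)
      refine one_div_le_one_div_of_le (by positivity) ?_
      exact_mod_cast (by omega : K + 1 ≤ k + N)
    rw [Finset.prod_range_succ, ← hl]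
    nlinarith

/-- The set `{|Aut(G)| / |G| : G a finite abelian group of odd order} ∩ [0, 1]` is
dense in `[0, 1]`. -/
theorem aut_ratio_odd_inter_unitInterval_dense :
    ∀ x ∈ Set.Icc (0 : ℝ) 1, x ∈ closure ({r : ℝ | ∃ (G : Type) (_ : CommGroup G) (_ : Finite G),
      Odd (Nat.card G) ∧ r = (Nat.card (G ≃* G) : ℝ) / (Nat.card G : ℝ)} ∩ Set.Icc (0 : ℝ) 1) := by
  intro x hx
  refine Metric.mem_closure_iff.2 fun ε hε => ?_
  obtain ⟨n, h_odd, hn⟩ := exists_odd_abs_totient_div_sub_lt hx hε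
  have : NeZero n := ⟨h_odd.pos.ne'⟩
  have h_card : Nat.card (Multiplicative (ZMod n)) = n := Nat.card_zmod n
  refine ⟨(n.totient : ℝ) / n, ⟨⟨Multiplicative (ZMod n), inferInstance,
    inferInstanceAs (Finite (ZMod n)), by rwa [h_card], ?_⟩, by positivity,
    div_le_one_of_le₀ (by exact_mod_cast n.totient_le) (by positivity)⟩, ?_⟩
  · have h_aut := IsCyclic.card_mulAut (Multiplicative (ZMod n))
    rw [h_card] at h_aut
    rw [h_card, ← h_aut]
  · rwa [dist_comm, Real.dist_eq]
end

section
/- For every real number a ≥ 0 and every ε > 0 there exists a finite abelian group G such that |Aut(G)|/|G| lies in the open interval (a − ε, a + ε). -/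
open Finset Filter

/-- A homomorphism between finite groups of coprime orders is trivial. -/
theorem MonoidHom.eq_one_of_coprime_card {G H : Type*} [Group G] [Group H]
    (h : (Nat.card G).Coprime (Nat.card H)) (f : G →* H) (x : G) : f x = 1 := by
  rw [← orderOf_eq_one_iff]
  exact Nat.eq_one_of_dvd_coprimes h
    ((orderOf_map_dvd f x).trans (orderOf_dvd_natCard x)) (orderOf_dvd_natCard (f x))

theorem MulEquiv.prodCongr_bijective_of_coprime_card {G H : Type*} [Group G] [Group H]
    [Finite G] [Finite H] (h : (Nat.card G).Coprime (Nat.card H)) :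
    Function.Bijective (fun e : (G ≃* G) × (H ≃* H) => MulEquiv.prodCongr e.1 e.2) := by
  constructor
  · rintro ⟨a, b⟩ ⟨c, d⟩ hab
    have key : ∀ x : G × H, (a x.1, b x.2) = (c x.1, d x.2) := fun x => congr($hab x)
    refine Prod.ext (MulEquiv.ext fun x => ?_) (MulEquiv.ext fun y => ?_)
    · exact congr(($(key (x, 1))).1)
    · exact congr(($(key (1, y))).2)
  · intro f
    let u : G →* G := (MonoidHom.fst G H).comp (f.toMonoidHom.comp (MonoidHom.inl G H))
    let v : H →* H := (MonoidHom.snd G H).comp (f.toMonoidHom.comp (MonoidHom.inr G H))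
    have hGH (x : G) : (f (x, 1)).2 = 1 := MonoidHom.eq_one_of_coprime_card h
      ((MonoidHom.snd G H).comp (f.toMonoidHom.comp (MonoidHom.inl G H))) x
    have hHG (y : H) : (f (1, y)).1 = 1 := MonoidHom.eq_one_of_coprime_card h.symm
      ((MonoidHom.fst G H).comp (f.toMonoidHom.comp (MonoidHom.inr G H))) y
    have hu (x : G) : f (x, 1) = (u x, 1) := Prod.ext rfl (hGH x)
    have hv (y : H) : f (1, y) = (1, v y) := Prod.ext (hHG y) rfl
    have hu_inj : Function.Injective u := fun x x' hx =>
      congr_arg Prod.fst (f.injective ((hu x).trans (hx ▸ (hu x').symm)))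
    have hv_inj : Function.Injective v := fun y y' hy =>
      congr_arg Prod.snd (f.injective ((hv y).trans (hy ▸ (hv y').symm)))
    refine ⟨(MulEquiv.ofBijective u (Finite.injective_iff_bijective.mp hu_inj),
      MulEquiv.ofBijective v (Finite.injective_iff_bijective.mp hv_inj)), MulEquiv.ext ?_⟩
    rintro ⟨x, y⟩
    have hxy : (x, y) = (x, 1) * ((1, y) : G × H) := by simp
    have hf : f (x, y) = (u x, v y) := by
      rw [hxy, map_mul, hu x, hv y]
      simp
    exact hf.symm

theorem Nat.card_mulEquiv_prod_of_coprime {G H : Type*} [Group G] [Group H]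
    [Finite G] [Finite H] (h : (Nat.card G).Coprime (Nat.card H)) :
    Nat.card (G × H ≃* G × H) = Nat.card (G ≃* G) * Nat.card (H ≃* H) := by
  rw [← Nat.card_prod,
    Nat.card_eq_of_bijective _ (MulEquiv.prodCongr_bijective_of_coprime_card h)]

theorem exists_aut_ratio_mul_one_sub_inv {G : Type} [CommGroup G] [Finite G] {q : ℕ}
    (hq : q.Prime) (h : (Nat.card G).Coprime q) :
    ∃ (G' : Type) (_ : CommGroup G') (_ : Finite G'), Nat.card G' = Nat.card G * q ∧
      (Nat.card (G' ≃* G') : ℝ) / Nat.card G' =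
        (Nat.card (G ≃* G) : ℝ) / Nat.card G * (1 - 1 / q) := by
  have : NeZero q := ⟨hq.ne_zero⟩
  have hcard : Nat.card (Multiplicative (ZMod q)) = q := by simp
  have haut : Nat.card (Multiplicative (ZMod q) ≃* Multiplicative (ZMod q)) = q - 1 := by
    have := IsCyclic.card_mulAut (Multiplicative (ZMod q))
    rwa [hcard, Nat.totient_prime hq] at this
  refine ⟨G × Multiplicative (ZMod q), inferInstance, inferInstance, ?_, ?_⟩
  · rw [Nat.card_prod, hcard]
  · rw [Nat.card_mulEquiv_prod_of_coprime (hcard.symm ▸ h), Nat.card_prod, hcard, haut]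
    have hq0 : (q : ℝ) ≠ 0 := mod_cast hq.ne_zero
    have hG0 : (Nat.card G : ℝ) ≠ 0 := mod_cast Nat.card_pos.ne'
    push_cast [hq.one_le]
    field_simp

theorem le_card_aut_zmod_sq_div {p : ℕ} (hp : p.Prime) :
    (p : ℝ) - 1 ≤
      (Nat.card (Multiplicative (Fin 2 → ZMod p) ≃* Multiplicative (Fin 2 → ZMod p)) : ℝ) /
        Nat.card (Multiplicative (Fin 2 → ZMod p)) := by
  have : Fact p.Prime := ⟨hp⟩
  have hcard : Nat.card (Multiplicative (Fin 2 → ZMod p)) = p ^ 2 := by simp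
  have hle : (p ^ 2 - 1) * (p ^ 2 - p) ≤
      Nat.card (Multiplicative (Fin 2 → ZMod p) ≃* Multiplicative (Fin 2 → ZMod p)) := by
    have hGL := Matrix.card_GL_field (𝔽 := ZMod p) 2
    simp only [ZMod.card, Fin.prod_univ_two, Fin.val_zero, Fin.val_one, pow_zero, pow_one] at hGL
    rw [← hGL]
    have : Finite (Multiplicative (Fin 2 → ZMod p) ≃* Multiplicative (Fin 2 → ZMod p)) :=
      Finite.of_injective (fun e => (e : _ → _)) DFunLike.coe_injective
    refine Nat.card_le_card_of_injective (fun A => AddEquiv.toMultiplicative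
      (LinearMap.GeneralLinearGroup.toLinearEquiv
        (Matrix.GeneralLinearGroup.toLin A)).toAddEquiv) fun A B hAB => ?_
    apply Matrix.GeneralLinearGroup.toLin.injective
    refine Units.ext (LinearMap.ext fun x => ?_)
    exact congr(Multiplicative.toAdd ($hAB (Multiplicative.ofAdd x)))
  have hp2 : (2 : ℝ) ≤ p := mod_cast hp.two_le
  have hsq : p ≤ p ^ 2 := Nat.le_self_pow two_ne_zero p
  have hle' : ((p : ℝ) ^ 2 - 1) * (p ^ 2 - p) ≤
      Nat.card (Multiplicative (Fin 2 → ZMod p) ≃* Multiplicative (Fin 2 → ZMod p)) := by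
    have := (Nat.cast_le (α := ℝ)).mpr hle
    push_cast [hsq, hp.one_le.trans hsq] at this
    exact this
  rw [hcard]
  push_cast
  rw [le_div_iff₀ (by positivity)]
  refine le_trans ?_ hle'
  have : 0 ≤ ((p : ℝ) - 1) * p * (p ^ 2 - 1 - p) :=
    mul_nonneg (mul_nonneg (by linarith) (by linarith)) (by nlinarith)
  nlinarith

/-- The reciprocal of `n + k` if this number is prime, and `0` otherwise. -/
noncomputable def shiftedPrimeReciprocal (k n : ℕ) : ℝ :=
  if (n + k).Prime then 1 / ((n + k : ℕ) : ℝ) else 0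

theorem shiftedPrimeReciprocal_nonneg (k n : ℕ) : 0 ≤ shiftedPrimeReciprocal k n := by
  unfold shiftedPrimeReciprocal
  split_ifs <;> positivity

theorem shiftedPrimeReciprocal_le {k : ℕ} (hk : 0 < k) (n : ℕ) :
    shiftedPrimeReciprocal k n ≤ 1 / k := by
  unfold shiftedPrimeReciprocal
  split_ifs
  · have : (0 : ℝ) < k := mod_cast hk
    exact one_div_le_one_div_of_le this (mod_cast Nat.le_add_left k n)
  · positivity

theorem tendsto_sum_shiftedPrimeReciprocal (k : ℕ) :
    Tendsto (fun N => ∑ n ∈ range N, shiftedPrimeReciprocal k n) atTop atTop := by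
  rw [← not_summable_iff_tendsto_nat_atTop_of_nonneg (shiftedPrimeReciprocal_nonneg k)]
  intro h
  refine not_summable_one_div_on_primes ((summable_nat_add_iff k).mp (h.congr fun n => ?_))
  simp [shiftedPrimeReciprocal, Set.indicator_apply]

theorem tendsto_prod_one_sub_shiftedPrimeReciprocal {k : ℕ} (hk : 0 < k) :
    Tendsto (fun N => ∏ n ∈ range N, (1 - shiftedPrimeReciprocal k n)) atTop (nhds 0) := by
  have hle (n : ℕ) : 0 ≤ 1 - shiftedPrimeReciprocal k n := by
    have hk1 : (1 : ℝ) / k ≤ 1 := by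
      rw [div_le_one (by exact_mod_cast hk)]
      exact_mod_cast hk
    linarith [shiftedPrimeReciprocal_le hk n]
  refine squeeze_zero (fun N => prod_nonneg fun n _ => hle n) (fun N => ?_)
    (Real.tendsto_exp_neg_atTop_nhds_zero.comp (tendsto_sum_shiftedPrimeReciprocal k))
  rw [Function.comp_apply, ← sum_neg_distrib, Real.exp_sum]
  exact prod_le_prod (fun n _ => hle n) fun n _ => Real.one_sub_le_exp_neg _

theorem exists_aut_ratio_mul_prod {G : Type} [CommGroup G] [Finite G] {k : ℕ}
    (hG : ∀ q, q.Prime → q ∣ Nat.card G → q < k) (N : ℕ) :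
    ∃ (G' : Type) (_ : CommGroup G') (_ : Finite G'),
      (∀ q, q.Prime → q ∣ Nat.card G' → q < N + k) ∧
      (Nat.card (G' ≃* G') : ℝ) / Nat.card G' =
        (Nat.card (G ≃* G) : ℝ) / Nat.card G *
          ∏ n ∈ range N, (1 - shiftedPrimeReciprocal k n) := by
  induction N with
  | zero => exact ⟨G, inferInstance, inferInstance, by simpa using hG, by simp⟩
  | succ N ih =>
    obtain ⟨H, _, _, hH, hr⟩ := ih
    rw [prod_range_succ, ← mul_assoc, ← hr]
    by_cases hq : (N + k).Prime
    · have hco : (Nat.card H).Coprime (N + k) :=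
        (hq.coprime_iff_not_dvd.mpr fun hd => (hH _ hq hd).false).symm
      obtain ⟨K, hK₁, hK₂, hcard, hratio⟩ := exists_aut_ratio_mul_one_sub_inv hq hco
      refine ⟨K, hK₁, hK₂, fun r hr hd => ?_, ?_⟩
      · rw [hcard, hr.dvd_mul, Nat.prime_dvd_prime_iff_eq hr hq] at hd
        rcases hd with hd | rfl
        · exact (hH r hr hd).trans (by omega)
        · omega
      · rw [hratio, shiftedPrimeReciprocal, if_pos hq]
    · exact ⟨H, inferInstance, inferInstance, fun r hr hd => (hH r hr hd).trans (by omega),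
        by simp [shiftedPrimeReciprocal, hq]⟩

/-- A sequence that starts above `a`, eventually drops below `a + ε`, and has downward steps
smaller than `2 * ε`, visits `(a - ε, a + ε)`. -/
theorem exists_mem_Ioo_of_small_steps {x : ℕ → ℝ} {a ε : ℝ} (hε : 0 < ε) (h₀ : a ≤ x 0)
    (hlt : ∃ N, x N < a + ε) (hstep : ∀ n, x n - x (n + 1) < 2 * ε) :
    ∃ N, x N ∈ Set.Ioo (a - ε) (a + ε) := by
  classical
  refine ⟨Nat.find hlt, ?_, Nat.find_spec hlt⟩
  rcases h : Nat.find hlt with _ | n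
  · linarith
  · have := Nat.find_min hlt (m := n) (by omega)
    linarith [hstep n]

/-- For every real `a ≥ 0` and every `ε > 0` there is a finite abelian group `G`
with `|Aut(G)|/|G| ∈ (a - ε, a + ε)`. -/
theorem exists_finAbelian_aut_ratio_near (a : ℝ) (ha : 0 ≤ a) (ε : ℝ) (hε : 0 < ε) :
    ∃ (G : Type) (_ : CommGroup G) (_ : Finite G),
      (Nat.card (G ≃* G) : ℝ) / (Nat.card G : ℝ) ∈ Set.Ioo (a - ε) (a + ε) := by
  obtain ⟨p, hpa, hp⟩ := Nat.exists_infinite_primes (⌈a⌉₊ + 1)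
  have : NeZero p := ⟨hp.ne_zero⟩
  let G := Multiplicative (Fin 2 → ZMod p)
  set R : ℝ := (Nat.card (G ≃* G) : ℝ) / Nat.card G
  have haR : a ≤ R := by
    refine le_trans ?_ (le_card_aut_zmod_sq_div hp)
    have : ((⌈a⌉₊ + 1 : ℕ) : ℝ) ≤ p := mod_cast hpa
    push_cast at this
    linarith [Nat.le_ceil a]
  obtain ⟨m, hm⟩ := exists_nat_gt (R / ε)
  set k := p + 1 + m
  have hk0 : 0 < k := by omega
  have hG (q : ℕ) (hq : q.Prime) (hd : q ∣ Nat.card G) : q < k := by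
    have hcard : Nat.card G = p ^ 2 := by simp [G]
    rw [hcard] at hd
    have := (Nat.prime_dvd_prime_iff_eq hq hp).mp (hq.dvd_of_dvd_pow hd)
    omega
  have hRk : R * (1 / k) < ε := by
    have hk' : (0 : ℝ) < k := mod_cast hk0
    have : (m : ℝ) ≤ k := mod_cast (by omega : m ≤ k)
    rw [mul_one_div, div_lt_iff₀ hk']
    rw [div_lt_iff₀ hε] at hm
    nlinarith
  let P : ℕ → ℝ := fun N => ∏ n ∈ range N, (1 - shiftedPrimeReciprocal k n)
  have hs_le (n : ℕ) : shiftedPrimeReciprocal k n ≤ 1 / k := shiftedPrimeReciprocal_le hk0 n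
  have hk1 : (1 : ℝ) / k ≤ 1 := by
    rw [div_le_one (by exact_mod_cast hk0)]
    exact_mod_cast hk0
  have hR0 : 0 ≤ R := ha.trans haR
  obtain ⟨N, hN⟩ := exists_mem_Ioo_of_small_steps (x := fun N => R * P N) (a := a) hε
    (by simpa [P])
    (by
      have hlim := (tendsto_prod_one_sub_shiftedPrimeReciprocal hk0).const_mul R
      rw [mul_zero] at hlim
      exact (hlim.eventually_lt_const (by linarith : 0 < a + ε)).exists)
    (fun n => by
      have hP1 : P n ≤ 1 := prod_le_one (fun i _ => by linarith [hs_le i])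
        fun i _ => by linarith [shiftedPrimeReciprocal_nonneg k i]
      have hP : R * P n - R * P (n + 1) = R * (P n * shiftedPrimeReciprocal k n) := by
        simp only [P, prod_range_succ]
        ring
      have hle : P n * shiftedPrimeReciprocal k n ≤ 1 / k :=
        (mul_le_of_le_one_left (shiftedPrimeReciprocal_nonneg k n) hP1).trans (hs_le n)
      linarith [mul_le_mul_of_nonneg_left hle hR0])
  obtain ⟨G', hG₁, hG₂, -, hratio⟩ := exists_aut_ratio_mul_prod hG N
  exact ⟨G', hG₁, hG₂, by rw [hratio]; exact hN⟩
end
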